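/- Let Λ be an artin algebra of finite global dimension. Then C_Λ contains a tilting-cotilting module if and only if Λ is an Auslander algebra, i.e., gldim Λ ≤ 2 ≤ domdim Λ. -/

import Mathlib

open Function LinearMap

section Prelim

variable (Λ : Type) [Ring Λ]

/-- A module that is both projective and injective. -/
def IsProjInj (M : Type) [AddCommGroup M] [Module Λ M] : Prop :=
  Module.Projective Λ M ∧ Module.Injective Λ M

/-- `X` is generated by the projective-injective modules: it is a quotient of a
finitely generated projective-injective module (equivalently, of a finite direct sum of
copies of `Q̃`). -/
def GenByProjInj (X : Type) [AddCommGroup X] [Module Λ X] : Prop :=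
  ∃ Q : ModuleCat.{0} Λ, Module.Finite Λ Q ∧ IsProjInj Λ Q ∧
    ∃ f : Q →ₗ[Λ] X, Surjective f

/-- `X` is cogenerated by the projective-injective modules: it embeds into a
finitely generated projective-injective module. -/
def CogenByProjInj (X : Type) [AddCommGroup X] [Module Λ X] : Prop :=
  ∃ Q : ModuleCat.{0} Λ, Module.Finite Λ Q ∧ IsProjInj Λ Q ∧
    ∃ f : X →ₗ[Λ] Q, Injective f

/-- Membership in `C_Λ = Gen(Q̃) ∩ Cogen(Q̃)`. -/
def MemC (X : Type) [AddCommGroup X] [Module Λ X] : Prop :=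
  GenByProjInj Λ X ∧ CogenByProjInj Λ X

/-- `pdLEcat Λ n X` : `X` has projective dimension at most `n`. -/
def pdLEcat : ℕ → ModuleCat.{0} Λ → Prop
  | 0, X => Module.Projective Λ X
  | n+1, X => ∃ (P : ModuleCat.{0} Λ) (g : P →ₗ[Λ] X),
      Module.Projective Λ P ∧ Module.Finite Λ P ∧ Surjective g ∧
      pdLEcat n (ModuleCat.of Λ (↥(LinearMap.ker g)))

/-- Projective dimension at most `n`, for a bare module. -/
def pdLE (n : ℕ) (X : Type) [AddCommGroup X] [Module Λ X] : Prop :=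
  pdLEcat Λ n (ModuleCat.of Λ X)

/-- `idLEcat Λ n X` : `X` has injective dimension at most `n`. -/
def idLEcat : ℕ → ModuleCat.{0} Λ → Prop
  | 0, X => Module.Injective Λ X
  | n+1, X => ∃ (I : ModuleCat.{0} Λ) (f : X →ₗ[Λ] I),
      Module.Injective Λ I ∧ Injective f ∧
      idLEcat n (ModuleCat.of Λ (↥I ⧸ LinearMap.range f))

/-- Injective dimension at most `n`, for a bare module. -/
def idLE (n : ℕ) (X : Type) [AddCommGroup X] [Module Λ X] : Prop :=
  idLEcat Λ n (ModuleCat.of Λ X)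

/-- Global dimension at most `d` (on finitely generated modules). -/
def GlobalDimLE (d : ℕ) : Prop :=
  ∀ X : ModuleCat.{0} Λ, Module.Finite Λ X → pdLEcat Λ d X

/-- Global dimension exactly `d`. -/
def GlobalDimEq (d : ℕ) : Prop :=
  GlobalDimLE Λ d ∧ ∀ m, GlobalDimLE Λ m → d ≤ m

/-- `Ext¹_Λ(Y, X) = 0`, expressed by the splitting of all short exact sequences
`0 → X → E → Y → 0`. -/
def Ext1Vanish (Y X : Type) [AddCommGroup Y] [Module Λ Y]
    [AddCommGroup X] [Module Λ X] : Prop :=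
  ∀ (E : ModuleCat.{0} Λ) (f : X →ₗ[Λ] E) (g : E →ₗ[Λ] Y),
    Injective f → Surjective g → LinearMap.range f = LinearMap.ker g →
    ∃ r : E →ₗ[Λ] X, r ∘ₗ f = LinearMap.id

/-- `M` belongs to `add T`: `M` is a direct summand of a finite direct sum of copies of `T`. -/
def InAddOf (T M : Type) [AddCommGroup T] [Module Λ T]
    [AddCommGroup M] [Module Λ M] : Prop :=
  ∃ (m : ℕ) (p : (Fin m → T) →ₗ[Λ] M) (s : M →ₗ[Λ] (Fin m → T)),
    p ∘ₗ s = LinearMap.id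

/-- A (classical) tilting module. -/
def IsTilting (T : Type) [AddCommGroup T] [Module Λ T] : Prop :=
  pdLE Λ 1 T ∧ Ext1Vanish Λ T T ∧
  ∃ (T0 T1 : ModuleCat.{0} Λ) (f : Λ →ₗ[Λ] T0) (g : T0 →ₗ[Λ] T1),
    InAddOf Λ T T0 ∧ InAddOf Λ T T1 ∧ Injective f ∧ Surjective g ∧
    LinearMap.range f = LinearMap.ker g

/-- A (classical) cotilting module. -/
def IsCotilting (T : Type) [AddCommGroup T] [Module Λ T] : Prop :=
  idLE Λ 1 T ∧ Ext1Vanish Λ T T ∧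
  ∀ (I : ModuleCat.{0} Λ), Module.Finite Λ I → Module.Injective Λ I →
    ∃ (C0 C1 : ModuleCat.{0} Λ) (u : C0 →ₗ[Λ] C1) (v : C1 →ₗ[Λ] I),
      InAddOf Λ T C0 ∧ InAddOf Λ T C1 ∧ Injective u ∧ Surjective v ∧
      LinearMap.range u = LinearMap.ker v

/-- Dominant dimension at least `2`: there is an exact sequence `0 → Λ → Q₀ → Q₁`
with `Q₀, Q₁` projective-injective. -/
def DomdimGE2 : Prop :=
  ∃ (Q0 Q1 : ModuleCat.{0} Λ) (f : Λ →ₗ[Λ] Q0) (g : Q0 →ₗ[Λ] Q1),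
    Module.Finite Λ Q0 ∧ IsProjInj Λ Q0 ∧ Module.Finite Λ Q1 ∧ IsProjInj Λ Q1 ∧
    Injective f ∧ LinearMap.range f = LinearMap.ker g

/-- An indecomposable (nonzero) module: the only idempotent endomorphisms are `0` and `id`. -/
def Indecomposable (M : Type) [AddCommGroup M] [Module Λ M] : Prop :=
  (∃ x : M, x ≠ 0) ∧ ∀ e : M →ₗ[Λ] M, e ∘ₗ e = e → e = 0 ∨ e = LinearMap.id

/-- A right minimal morphism. -/
def RightMinimal {B C : Type} [AddCommGroup B] [Module Λ B] [AddCommGroup C] [Module Λ C]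
    (f : B →ₗ[Λ] C) : Prop :=
  ∀ g : B →ₗ[Λ] B, f ∘ₗ g = f → Bijective g

/-- A left minimal morphism. -/
def LeftMinimal {A B : Type} [AddCommGroup A] [Module Λ A] [AddCommGroup B] [Module Λ B]
    (f : A →ₗ[Λ] B) : Prop :=
  ∀ g : B →ₗ[Λ] B, g ∘ₗ f = f → Bijective g

/-- `f : P → X` is a projective cover: `P` is projective, `f` is surjective and its kernel
is superfluous. -/
def IsProjCover {P X : Type} [AddCommGroup P] [Module Λ P] [AddCommGroup X] [Module Λ X]
    (f : P →ₗ[Λ] X) : Prop :=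
  Module.Projective Λ P ∧ Surjective f ∧
    ∀ N : Submodule Λ P, N ⊔ LinearMap.ker f = ⊤ → N = ⊤

/-- `f : X → I` is an injective envelope: `I` is injective, `f` is injective and its image is
essential. -/
def IsInjEnv {X I : Type} [AddCommGroup X] [Module Λ X] [AddCommGroup I] [Module Λ I]
    (f : X →ₗ[Λ] I) : Prop :=
  Module.Injective Λ I ∧ Injective f ∧
    ∀ N : Submodule Λ I, N ⊓ LinearMap.range f = ⊥ → N = ⊥

/-- An essential submodule. -/
def IsEssentialSub {M : Type} [AddCommGroup M] [Module Λ M] (N : Submodule Λ M) : Prop :=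
  ∀ N' : Submodule Λ M, N ⊓ N' = ⊥ → N' = ⊥

/-- A uniserial module: submodules are totally ordered by inclusion. -/
def Uniserial (M : Type) [AddCommGroup M] [Module Λ M] : Prop :=
  ∀ N₁ N₂ : Submodule Λ M, N₁ ≤ N₂ ∨ N₂ ≤ N₁

/-- The radical of a module: the intersection of its maximal submodules. -/
def radSub (M : Type) [AddCommGroup M] [Module Λ M] : Submodule Λ M :=
  sInf {N : Submodule Λ M | IsCoatom N}

/-- An almost split (Auslander-Reiten) sequence `0 → A → E → C → 0`. -/
def IsAlmostSplitSeq {A E C : Type} [AddCommGroup A] [Module Λ A]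
    [AddCommGroup E] [Module Λ E] [AddCommGroup C] [Module Λ C]
    (f : A →ₗ[Λ] E) (g : E →ₗ[Λ] C) : Prop :=
  Injective f ∧ Surjective g ∧ LinearMap.range f = LinearMap.ker g ∧
  (¬∃ r : E →ₗ[Λ] A, r ∘ₗ f = LinearMap.id) ∧
  Indecomposable Λ A ∧ Indecomposable Λ C ∧
  ∀ (Z : ModuleCat.{0} Λ) (h : Z →ₗ[Λ] C), Module.Finite Λ Z →
    (¬∃ s : C →ₗ[Λ] Z, h ∘ₗ s = LinearMap.id) → ∃ l : (Z →ₗ[Λ] E), g ∘ₗ l = h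

/-- `N` is the Auslander-Reiten translate `τ M` of `M`: writing `M ≅ P ⊕ (⊕ᵢ Cᵢ)` with `P`
projective and `Cᵢ` indecomposable ends of almost split sequences `0 → Aᵢ → Eᵢ → Cᵢ → 0`,
we have `N ≅ ⊕ᵢ Aᵢ`. -/
def IsTauOf (N M : Type) [AddCommGroup N] [Module Λ N] [AddCommGroup M] [Module Λ M] : Prop :=
  ∃ (r : ℕ) (P : ModuleCat.{0} Λ) (A E C : Fin r → ModuleCat.{0} Λ)
    (f : ∀ i, (A i : Type) →ₗ[Λ] (E i : Type)) (g : ∀ i, (E i : Type) →ₗ[Λ] (C i : Type)),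
    Module.Projective Λ P ∧ (∀ i, IsAlmostSplitSeq Λ (f i) (g i)) ∧
    Nonempty (M ≃ₗ[Λ] (Prod (P : Type) ((i : Fin r) → (C i : Type)))) ∧
    Nonempty (N ≃ₗ[Λ] (∀ i, (A i : Type)))

end Prelim

section HomModule

variable {R : Type} [Ring R] {T M : Type} [AddCommGroup T] [Module R T]
  [AddCommGroup M] [Module R M]

/-- `Hom_R(T, M)` as a left module over `B = End_R(T)ᵒᵖ`, via precomposition. -/
instance instSMulHomEndOp : SMul (Module.End R T)ᵐᵒᵖ (T →ₗ[R] M) :=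
  ⟨fun b f => f ∘ₗ b.unop⟩

lemma endOp_smul_def (b : (Module.End R T)ᵐᵒᵖ) (f : T →ₗ[R] M) :
    b • f = f ∘ₗ b.unop := rfl

instance instMulActionHomEndOp : MulAction (Module.End R T)ᵐᵒᵖ (T →ₗ[R] M) where
  one_smul f := by ext x; rfl
  mul_smul b c f := by ext x; rfl

instance instDistribMulActionHomEndOp :
    DistribMulAction (Module.End R T)ᵐᵒᵖ (T →ₗ[R] M) where
  smul_zero b := by ext x; rfl
  smul_add b f g := by ext x; rfl

instance instModuleHomEndOp : Module (Module.End R T)ᵐᵒᵖ (T →ₗ[R] M) where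
  add_smul b c f := by ext x; simp [endOp_smul_def]
  zero_smul f := by ext x; simp [endOp_smul_def]

end HomModule

section ExtLayer

open CategoryTheory CategoryTheory.Abelian

variable {Λ : Type} [Ring Λ]

/-- `Ext^n(X,Y) = 0`. -/
def EV (Λ : Type) [Ring Λ] (n : ℕ) (X Y : Type) [AddCommGroup X] [Module Λ X]
    [AddCommGroup Y] [Module Λ Y] : Prop :=
  ∀ e : Ext (ModuleCat.of Λ X) (ModuleCat.of Λ Y) n, e = 0

variable {A B C X : Type} [AddCommGroup A] [Module Λ A] [AddCommGroup B] [Module Λ B]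
  [AddCommGroup C] [Module Λ C] [AddCommGroup X] [Module Λ X]

/-- short exact sequence of modules -/
structure SES (f : A →ₗ[Λ] B) (g : B →ₗ[Λ] C) : Prop where
  inj : Injective f
  surj : Surjective g
  ex : LinearMap.range f = LinearMap.ker g

/-- the associated short complex -/
abbrev SES.sc {f : A →ₗ[Λ] B} {g : B →ₗ[Λ] C} (h : SES f g) : ShortComplex (ModuleCat.{0} Λ) :=
  ShortComplex.mk (ModuleCat.ofHom f) (ModuleCat.ofHom g) (by
    ext x
    have : f x ∈ LinearMap.ker g := h.ex ▸ ⟨x, rfl⟩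
    simpa using this)

lemma SES.se {f : A →ₗ[Λ] B} {g : B →ₗ[Λ] C} (h : SES f g) : h.sc.ShortExact :=
  { exact := ShortComplex.Exact.moduleCat_of_range_eq_ker (ModuleCat.ofHom f) (ModuleCat.ofHom g) h.ex
    mono_f := (ModuleCat.mono_iff_injective _).2 h.inj
    epi_g := (ModuleCat.epi_iff_surjective _).2 h.surj }

/-- cov (third term) -/
lemma SES.cov3 {f : A →ₗ[Λ] B} {g : B →ₗ[Λ] C} (h : SES f g) {n : ℕ}
    (h2 : EV Λ n X B) (h1 : EV Λ (n+1) X A) : EV Λ n X C := by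
  intro e
  obtain ⟨y, rfl⟩ := Ext.covariant_sequence_exact₃ _ h.se e rfl (h1 _)
  rw [h2 y]; simp

lemma SES.cov1 {f : A →ₗ[Λ] B} {g : B →ₗ[Λ] C} (h : SES f g) {n : ℕ}
    (h3 : EV Λ n X C) (h2 : EV Λ (n+1) X B) : EV Λ (n+1) X A := by
  intro e
  obtain ⟨y, rfl⟩ := Ext.covariant_sequence_exact₁ _ h.se e (h2 _) rfl
  rw [h3 y]; simp

lemma SES.contra3 {f : A →ₗ[Λ] B} {g : B →ₗ[Λ] C} (h : SES f g) {n : ℕ}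
    (h1 : EV Λ n A X) (h2 : EV Λ (n+1) B X) : EV Λ (n+1) C X := by
  intro e
  obtain ⟨y, rfl⟩ := Ext.contravariant_sequence_exact₃ h.se _ e (h2 _) (add_comm 1 n)
  rw [h1 y]; simp

lemma SES.contra1 {f : A →ₗ[Λ] B} {g : B →ₗ[Λ] C} (h : SES f g) {n : ℕ}
    (h2 : EV Λ n B X) (h3 : EV Λ (n+1) C X) : EV Λ n A X := by
  intro e
  obtain ⟨y, rfl⟩ := Ext.contravariant_sequence_exact₁ h.se _ e (add_comm 1 n) (h3 _)
  rw [h2 y]; simp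

lemma SES.extend {f : A →ₗ[Λ] B} {g : B →ₗ[Λ] C} (h : SES f g)
    (h3 : EV Λ 1 C X) (φ : A →ₗ[Λ] X) : ∃ ψ : B →ₗ[Λ] X, ψ ∘ₗ f = φ := by
  obtain ⟨y, hy⟩ := Ext.contravariant_sequence_exact₁ h.se _
    (Ext.mk₀ (ModuleCat.ofHom φ)) (add_comm 1 0) (h3 _)
  obtain ⟨ψ, rfl⟩ := Ext.homEquiv₀.symm.surjective y
  refine ⟨ψ.hom, ?_⟩
  simp only [Ext.homEquiv₀_symm_apply, Ext.mk₀_comp_mk₀] at hy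
  have := (Ext.mk₀_bijective _ _).1 hy
  exact congrArg ModuleCat.Hom.hom this

lemma SES.lift {f : A →ₗ[Λ] B} {g : B →ₗ[Λ] C} (h : SES f g)
    (h3 : EV Λ 1 X A) (φ : X →ₗ[Λ] C) : ∃ ψ : X →ₗ[Λ] B, g ∘ₗ ψ = φ := by
  obtain ⟨y, hy⟩ := Ext.covariant_sequence_exact₃ _ h.se
    (Ext.mk₀ (ModuleCat.ofHom φ)) (zero_add 1) (h3 _)
  obtain ⟨ψ, rfl⟩ := Ext.homEquiv₀.symm.surjective y
  refine ⟨ψ.hom, ?_⟩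
  simp only [Ext.homEquiv₀_symm_apply, Ext.mk₀_comp_mk₀] at hy
  have := (Ext.mk₀_bijective _ _).1 hy
  exact congrArg ModuleCat.Hom.hom this

lemma SES.EV_of_extend {f : A →ₗ[Λ] B} {g : B →ₗ[Λ] C} (h : SES f g)
    (hB : EV Λ 1 B X) (H : ∀ φ : A →ₗ[Λ] X, ∃ ψ : B →ₗ[Λ] X, ψ ∘ₗ f = φ) : EV Λ 1 C X := by
  intro e
  obtain ⟨y, rfl⟩ := Ext.contravariant_sequence_exact₃ h.se _ e (hB _) (add_comm 1 0)
  obtain ⟨φ, rfl⟩ := Ext.homEquiv₀.symm.surjective y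
  obtain ⟨ψ, hψ⟩ := H φ.hom
  have : φ = ModuleCat.ofHom f ≫ ModuleCat.ofHom ψ := by
    ext x; exact (LinearMap.congr_fun hψ x).symm
  subst this
  simp only [Ext.homEquiv₀_symm_apply]
  rw [← Ext.mk₀_comp_mk₀]
  exact h.se.extClass_comp_assoc _

lemma SES.EV_of_lift {f : A →ₗ[Λ] B} {g : B →ₗ[Λ] C} (h : SES f g)
    (hB : EV Λ 1 X B) (H : ∀ φ : X →ₗ[Λ] C, ∃ ψ : X →ₗ[Λ] B, g ∘ₗ ψ = φ) : EV Λ 1 X A := by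
  intro e
  obtain ⟨y, rfl⟩ := Ext.covariant_sequence_exact₁ _ h.se e (hB _) (zero_add 1)
  obtain ⟨φ, rfl⟩ := Ext.homEquiv₀.symm.surjective y
  obtain ⟨ψ, hψ⟩ := H φ.hom
  have : φ = ModuleCat.ofHom ψ ≫ ModuleCat.ofHom g := by
    ext x; exact (LinearMap.congr_fun hψ x).symm
  subst this
  simp only [Ext.homEquiv₀_symm_apply]
  rw [← Ext.mk₀_comp_mk₀, Ext.comp_assoc_of_second_deg_zero]
  have := h.se.comp_extClass
  simp only at this
  rw [this]; simp

lemma EV_proj (n : ℕ) [Module.Projective Λ A] : EV Λ (n+1) A X := by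
  intro e
  exact Ext.eq_zero_of_projective e

lemma EV_inj (n : ℕ) [Module.Injective Λ A] : EV Λ (n+1) X A := by
  intro e
  have := Module.injective_object_of_injective_module Λ A
  exact Ext.eq_zero_of_injective e

lemma EV_sum_right {n : ℕ} {ι : Type} [Fintype ι] (a : ι → (A →ₗ[Λ] B)) (b : ι → (B →ₗ[Λ] A))
    (hab : ∑ i, a i ∘ₗ b i = LinearMap.id) (h : EV Λ n X A) : EV Λ n X B := by
  intro e
  have h1 : 𝟙 (ModuleCat.of Λ B) = ∑ i, ModuleCat.ofHom (b i) ≫ ModuleCat.ofHom (a i) := by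
    apply ModuleCat.hom_ext
    rw [ModuleCat.hom_sum]
    simpa using hab.symm
  have h2 := e.comp_mk₀_id
  rw [h1, Ext.mk₀_sum, Ext.comp_sum] at h2
  rw [← h2]
  apply Finset.sum_eq_zero
  intro i _
  rw [← Ext.mk₀_comp_mk₀, ← Ext.comp_assoc_of_third_deg_zero, h (e.comp _ _)]
  simp

lemma EV_sum_left {n : ℕ} {ι : Type} [Fintype ι] (a : ι → (A →ₗ[Λ] B)) (b : ι → (B →ₗ[Λ] A))
    (hab : ∑ i, a i ∘ₗ b i = LinearMap.id) (h : EV Λ n A X) : EV Λ n B X := by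
  intro e
  have h1 : 𝟙 (ModuleCat.of Λ B) = ∑ i, ModuleCat.ofHom (b i) ≫ ModuleCat.ofHom (a i) := by
    apply ModuleCat.hom_ext
    rw [ModuleCat.hom_sum]
    simpa using hab.symm
  have h2 := e.mk₀_id_comp
  rw [h1, Ext.mk₀_sum, Ext.sum_comp] at h2
  rw [← h2]
  apply Finset.sum_eq_zero
  intro i _
  rw [← Ext.mk₀_comp_mk₀, Ext.comp_assoc_of_second_deg_zero, h (Ext.comp _ e _)]
  simp

lemma ses_ker {g : B →ₗ[Λ] C} (hg : Surjective g) : SES (LinearMap.ker g).subtype g :=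
  ⟨Subtype.val_injective, hg, by simp⟩

lemma ses_coker {f : A →ₗ[Λ] B} (hf : Injective f) : SES f (LinearMap.range f).mkQ :=
  ⟨hf, Submodule.mkQ_surjective _, by simp⟩

lemma InAddOf.sum {T M : Type} [AddCommGroup T] [Module Λ T]
    [AddCommGroup M] [Module Λ M] (h : InAddOf Λ T M) :
    ∃ (m : ℕ) (a : Fin m → (T →ₗ[Λ] M)) (b : Fin m → (M →ₗ[Λ] T)),
      ∑ i, a i ∘ₗ b i = LinearMap.id := by
  obtain ⟨m, p, s, h⟩ := h
  refine ⟨m, fun i => p ∘ₗ LinearMap.single Λ (fun _ => T) i, fun i => LinearMap.proj i ∘ₗ s, ?_⟩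
  ext x
  have := LinearMap.congr_fun h x
  simp only [LinearMap.sum_apply, LinearMap.comp_apply, LinearMap.proj_apply] at this ⊢
  rw [← map_sum, ← this]
  simp [LinearMap.single_apply, Finset.univ_sum_single]

lemma EV_add_right {T M : Type} [AddCommGroup T] [Module Λ T]
    [AddCommGroup M] [Module Λ M] (h : InAddOf Λ T M) {n : ℕ} (hT : EV Λ n X T) : EV Λ n X M := by
  obtain ⟨m, a, b, hab⟩ := h.sum
  exact EV_sum_right a b hab hT

lemma EV_add_left {T M : Type} [AddCommGroup T] [Module Λ T]
    [AddCommGroup M] [Module Λ M] (h : InAddOf Λ T M) {n : ℕ} (hT : EV Λ n T X) : EV Λ n M X := by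
  obtain ⟨m, a, b, hab⟩ := h.sum
  exact EV_sum_left a b hab hT

lemma ext1Vanish_iff {Y : Type} [AddCommGroup Y] [Module Λ Y] :
    Ext1Vanish Λ Y X ↔ EV Λ 1 Y X := by
  constructor
  · intro H
    let g : (Y →₀ Λ) →ₗ[Λ] Y := Finsupp.linearCombination Λ id
    have hg : Surjective g := fun y => ⟨Finsupp.single y 1, by simp [g]⟩
    refine (ses_ker hg).EV_of_extend (EV_proj 0) ?_
    intro φ
    let j : LinearMap.ker g →ₗ[Λ] X × (Y →₀ Λ) := φ.prod (-(LinearMap.ker g).subtype)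
    let q := (LinearMap.range j).mkQ
    let f : X →ₗ[Λ] ((X × (Y →₀ Λ)) ⧸ LinearMap.range j) := q ∘ₗ LinearMap.inl Λ _ _
    let g' : ((X × (Y →₀ Λ)) ⧸ LinearMap.range j) →ₗ[Λ] Y :=
      (LinearMap.range j).liftQ (g ∘ₗ LinearMap.snd Λ _ _) (by
        rintro _ ⟨x, rfl⟩
        simp [j])
    have hg' : ∀ z, g' (q z) = g z.2 := fun z => rfl
    have hq : ∀ z, q z = 0 ↔ ∃ x, j x = z := fun z => by simp [q]
    obtain ⟨r, hr⟩ := H (ModuleCat.of Λ ((X × (Y →₀ Λ)) ⧸ LinearMap.range j)) f g' (by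
        rw [injective_iff_map_eq_zero]
        intro x hx
        obtain ⟨y, hy⟩ := (hq _).1 hx
        have h1 : φ y = x := congrArg Prod.fst hy
        have h2 : -(y : Y →₀ Λ) = 0 := congrArg Prod.snd hy
        have : y = 0 := Subtype.ext (by simpa using h2)
        rw [← h1, this, map_zero]) (by
        intro y
        obtain ⟨p, hp⟩ := hg y
        exact ⟨q (0, p), by rw [hg']; exact hp⟩) (by
        apply le_antisymm
        · rintro _ ⟨x, rfl⟩
          show g' (q _) = 0
          rw [hg']; simp
        · intro e he
          obtain ⟨⟨x, p⟩, rfl⟩ := Submodule.mkQ_surjective _ e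
          have hp : g p = 0 := he
          refine ⟨x + φ ⟨p, hp⟩, ?_⟩
          show q _ = q _
          rw [← sub_eq_zero, ← map_sub, hq]
          refine ⟨⟨p, hp⟩, ?_⟩
          ext <;> simp [j])
    refine ⟨r ∘ₗ q ∘ₗ LinearMap.inr Λ _ _, ?_⟩
    ext k
    have h1 := LinearMap.congr_fun hr (φ k)
    have h2 : q (0, (k : Y →₀ Λ)) = q (φ k, 0) := by
      rw [eq_comm, ← sub_eq_zero, ← map_sub, hq]
      exact ⟨k, by ext <;> simp [j]⟩
    show r (q (0, (k : Y →₀ Λ))) = φ k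
    rw [h2]
    exact h1
  · intro h E f g hf hg hfg
    exact SES.extend (Λ := Λ) (C := Y) (B := E) ⟨hf, hg, hfg⟩ h LinearMap.id

lemma pdLEcat_EV : ∀ (n : ℕ) (M : ModuleCat.{0} Λ), pdLEcat Λ n M → ∀ i, n < i → EV Λ i M X
  | 0, M, h, i + 1, _ => by
      have : Module.Projective Λ M := h
      exact EV_proj i
  | n+1, M, h, i + 1, hi => by
      obtain ⟨P, g, hP, _, hg, hK⟩ := h
      refine (ses_ker hg).contra3 (pdLEcat_EV n _ hK i (by omega)) (EV_proj i)

lemma idLEcat_EV : ∀ (n : ℕ) (M : ModuleCat.{0} Λ), idLEcat Λ n M → ∀ i, n < i → EV Λ i X M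
  | 0, M, h, i + 1, _ => by
      have : Module.Injective Λ M := h
      exact EV_inj i
  | n+1, M, h, i + 1, hi => by
      obtain ⟨P, g, hP, hg, hK⟩ := h
      refine (ses_coker hg).cov1 (idLEcat_EV n _ hK i (by omega)) (EV_inj i)

lemma injective_of_EV (h : ∀ I : Ideal Λ, EV Λ 1 (Λ ⧸ I) X) : Module.Injective Λ X := by
  apply Module.Baer.injective
  intro I g
  have hs : SES (Λ := Λ) I.subtype (Submodule.mkQ I) :=
    ⟨Subtype.val_injective, Submodule.mkQ_surjective _, by simp⟩
  obtain ⟨ψ, hψ⟩ := hs.extend (h I) g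
  exact ⟨ψ, fun x hx => LinearMap.congr_fun hψ ⟨x, hx⟩⟩

end ExtLayer

section Hull

variable {Λ : Type} [Ring Λ]

lemma exists_injective_emb (X : Type) [AddCommGroup X] [Module Λ X] :
    ∃ (I : ModuleCat.{0} Λ) (f : X →ₗ[Λ] I), Module.Injective Λ I ∧ Injective f := by
  obtain ⟨⟨I, hI, f, hf⟩⟩ := CategoryTheory.EnoughInjectives.presentation (ModuleCat.of Λ X)
  refine ⟨I, f.hom, ?_, (ModuleCat.mono_iff_injective _).1 hf⟩
  exact Module.injective_module_of_injective_object Λ I (inj := hI)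

lemma injective_of_retract {I E : Type} [AddCommGroup I] [Module Λ I] [AddCommGroup E] [Module Λ E]
    [hI : Module.Injective Λ I] (s : E →ₗ[Λ] I) (p : I →ₗ[Λ] E) (h : ∀ x, p (s x) = x) :
    Module.Injective Λ E := by
  constructor
  intro X Y _ _ _ _ f hf g
  obtain ⟨h', hh⟩ := hI.out f hf (s ∘ₗ g)
  exact ⟨p ∘ₗ h', fun x => by simp [hh, h]⟩

/-- `S` is essential in `E` -/
def EssIn {I : Type} [AddCommGroup I] [Module Λ I] (S E : Submodule Λ I) : Prop :=
  ∀ N : Submodule Λ I, N ≤ E → N ⊓ S = ⊥ → N = ⊥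

lemma essIn_iff {I : Type} [AddCommGroup I] [Module Λ I] (S E : Submodule Λ I) :
    EssIn S E ↔ ∀ x ∈ E, x ≠ 0 → ∃ a : Λ, a • x ∈ S ∧ a • x ≠ 0 := by
  constructor
  · intro h x hx hx0
    by_contra! hc
    have := h (Λ ∙ x) (by simpa using hx) (by
      rw [eq_bot_iff]
      rintro y ⟨hy, hyS⟩
      obtain ⟨a, rfl⟩ := Submodule.mem_span_singleton.1 hy
      exact hc a hyS)
    exact hx0 (by simpa using this)
  · intro h N hN hNS
    rw [eq_bot_iff]
    intro x hx
    by_contra hx0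
    obtain ⟨a, h1, h2⟩ := h x (hN hx) hx0
    have : a • x ∈ N ⊓ S := ⟨N.smul_mem a hx, h1⟩
    rw [hNS] at this
    exact h2 this

lemma exists_hull (X : Type) [AddCommGroup X] [Module Λ X] :
    ∃ (E : ModuleCat.{0} Λ) (f : X →ₗ[Λ] E), Module.Injective Λ E ∧ Injective f ∧
      ∀ x : E, x ≠ 0 → ∃ a : Λ, a • x ∈ LinearMap.range f ∧ a • x ≠ 0 := by
  obtain ⟨I, f, hI, hf⟩ := exists_injective_emb (Λ := Λ) X
  let S := LinearMap.range f
  obtain ⟨E, hSE, hE⟩ := zorn_le_nonempty₀ {E : Submodule Λ I | S ≤ E ∧ EssIn S E} (by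
    intro c hc hchain y hy
    refine ⟨sSup c, ⟨?_, ?_⟩, fun z hz => le_sSup hz⟩
    · exact (hc hy).1.trans (le_sSup hy)
    · rw [essIn_iff]
      intro x hx hx0
      obtain ⟨z, hz, hxz⟩ := (Submodule.mem_sSup_of_directed ⟨y, hy⟩ hchain.directedOn).1 hx
      exact (essIn_iff _ _).1 (hc hz).2 x hxz hx0) S ⟨le_rfl, (essIn_iff _ _).2
        fun x hx hx0 => ⟨1, by simpa using hx, by simpa using hx0⟩⟩
  obtain ⟨N, -, hN⟩ := zorn_le_nonempty₀ {N : Submodule Λ I | N ⊓ E = ⊥} (by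
    intro c hc hchain y hy
    refine ⟨sSup c, ?_, fun z hz => le_sSup hz⟩
    show sSup c ⊓ E = ⊥
    rw [eq_bot_iff]
    rintro x ⟨hx, hxE⟩
    obtain ⟨z, hz, hxz⟩ := (Submodule.mem_sSup_of_directed ⟨y, hy⟩ hchain.directedOn).1 hx
    have : x ∈ z ⊓ E := ⟨hxz, hxE⟩
    rwa [show z ⊓ E = ⊥ from hc hz] at this) ⊥ (by simp)
  have hNE : N ⊓ E = ⊥ := hN.prop
  let j : E →ₗ[Λ] I ⧸ N := N.mkQ ∘ₗ E.subtype
  have hj : Injective j := by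
    rw [injective_iff_map_eq_zero]
    intro x hx
    have h1 : (x : I) ∈ N := by simpa [j] using hx
    have : (x : I) ∈ N ⊓ E := ⟨h1, x.2⟩
    rw [hNE] at this
    exact Subtype.ext (by simpa using this)
  obtain ⟨h, hh⟩ := hI.out j hj E.subtype
  -- essentiality of `E` in `I ⧸ N`
  have hess : ∀ z : I ⧸ N, z ≠ 0 → ∃ a : Λ, a • z ≠ 0 ∧ a • z ∈ LinearMap.range j := by
    intro z hz
    obtain ⟨y, rfl⟩ := N.mkQ_surjective z
    have hyN : y ∉ N := by simpa using hz
    by_contra! hc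
    have : N ⊔ (Λ ∙ y) ∈ {N : Submodule Λ I | N ⊓ E = ⊥} := by
      show _ ⊓ _ = ⊥
      rw [eq_bot_iff]
      rintro x ⟨hx, hxE⟩
      obtain ⟨n, hn, w, hw, rfl⟩ := Submodule.mem_sup.1 hx
      obtain ⟨a, rfl⟩ := Submodule.mem_span_singleton.1 hw
      have hq : N.mkQ (n + a • y) = a • N.mkQ y := by
        rw [map_add, map_smul, (Submodule.Quotient.mk_eq_zero N).2 hn |> (fun h => (h : N.mkQ n = 0)),
          zero_add]
      have h1 : a • N.mkQ y = 0 := by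
        by_contra h0
        exact hc a h0 ⟨⟨_, hxE⟩, hq⟩
      have : j ⟨_, hxE⟩ = 0 := hq.trans h1
      have := (injective_iff_map_eq_zero j).1 hj _ this
      simpa using congrArg Subtype.val this
    have h2 := hN.le_of_ge this le_sup_left
    exact hyN (h2 (Submodule.mem_sup_right (Submodule.mem_span_singleton_self y)))
  have hrange : LinearMap.range h ≤ E := by
    apply hE.le_of_ge
    · constructor
      · intro x hx
        exact ⟨j ⟨x, hSE hx⟩, hh _⟩
      · rw [essIn_iff]
        rintro _ ⟨z, rfl⟩ hz0
        obtain ⟨a, ha0, e, hae⟩ := hess z (fun h0 => hz0 (by simp [h0]))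
        have he : a • h z = e := by rw [← map_smul, ← hae, hh]; rfl
        have he0 : (e : I) ≠ 0 := by
          intro h0
          have : e = 0 := Subtype.ext h0
          rw [this, map_zero] at hae
          exact ha0 hae.symm
        obtain ⟨b, hb, hb0⟩ := (essIn_iff _ _).1 hE.prop.2 e e.2 he0
        exact ⟨b * a, by rwa [mul_smul, he], by rwa [mul_smul, he]⟩
    · intro x hx
      exact ⟨j ⟨x, hx⟩, hh _⟩
  let p : I →ₗ[Λ] E := (h ∘ₗ N.mkQ).codRestrict E (fun x => hrange ⟨_, rfl⟩)
  have hinj : Module.Injective Λ E := injective_of_retract E.subtype p (fun x => Subtype.ext (hh x))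
  refine ⟨ModuleCat.of Λ E, f.codRestrict E (fun x => hSE ⟨x, rfl⟩), hinj, ?_, ?_⟩
  · intro x y hxy
    exact hf (congrArg Subtype.val hxy)
  · intro x hx
    obtain ⟨a, ⟨y, hy⟩, ha0⟩ := (essIn_iff _ _).1 hE.prop.2 x x.2 (fun h => hx (Subtype.ext h))
    exact ⟨a, ⟨y, Subtype.ext hy⟩, fun h => ha0 (congrArg Subtype.val h)⟩

lemma hom_noeth {k : Type} [CommRing k] [IsArtinianRing k] [Algebra k Λ]
    {X E : Type} [AddCommGroup X] [Module Λ X] [AddCommGroup E] [Module Λ E]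
    [Module k X] [IsScalarTower k Λ X] [Module.Finite k X] [Module k E] [IsScalarTower k Λ E]
    (f : X →ₗ[Λ] E) (hf : Injective f)
    (hess : ∀ x : E, x ≠ 0 → ∃ a : Λ, a • x ∈ LinearMap.range f ∧ a • x ≠ 0)
    {M : Type} [AddCommGroup M] [Module Λ M] (hM : IsFiniteLength Λ M) :
    haveI : SMulCommClass Λ k E := IsScalarTower.to_smulCommClass'
    IsNoetherian k (M →ₗ[Λ] E) := by
  have : SMulCommClass Λ k E := IsScalarTower.to_smulCommClass'
  show IsNoetherian k (M →ₗ[Λ] E)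
  induction hM with
  | of_subsingleton => 
    rename_i M _ _ _
    have : Subsingleton (M →ₗ[Λ] E) := ⟨fun a b => by ext x; simp [Subsingleton.elim x 0]⟩
    infer_instance
  | of_simple_quotient hN ih =>
    rename_i M _ _ N hS
    have := IsSimpleModule.nontrivial Λ (M ⧸ N)
    obtain ⟨s, hs⟩ := exists_ne (0 : M ⧸ N)
    have hspan := IsSimpleModule.span_singleton_eq_top Λ hs
    let ev : ((M ⧸ N) →ₗ[Λ] E) →ₗ[k] E :=
      { toFun := fun φ => φ s, map_add' := fun _ _ => rfl, map_smul' := fun _ _ => rfl }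
    have hev : Injective ev := by
      rw [injective_iff_map_eq_zero]
      intro φ hφ
      ext x
      have : N.mkQ x ∈ Submodule.span Λ {s} := hspan ▸ Submodule.mem_top
      obtain ⟨a, ha⟩ := Submodule.mem_span_singleton.1 this
      have h0 : φ s = 0 := hφ
      show φ (N.mkQ x) = 0
      rw [← ha, map_smul, h0, smul_zero]
    have hr : LinearMap.range ev ≤ LinearMap.range (f.restrictScalars k) := by
      rintro _ ⟨φ, rfl⟩
      show φ s ∈ LinearMap.range f
      by_cases h0 : φ s = 0
      · rw [h0]; exact zero_mem _
      obtain ⟨a, ha, ha0⟩ := hess _ h0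
      have has : a • s ≠ 0 := fun h => ha0 (by rw [← map_smul, h, map_zero])
      have hspan' := IsSimpleModule.span_singleton_eq_top Λ has
      have : s ∈ Submodule.span Λ {a • s} := hspan' ▸ Submodule.mem_top
      obtain ⟨b, hb⟩ := Submodule.mem_span_singleton.1 this
      rw [← hb, map_smul, map_smul]
      exact Submodule.smul_mem _ _ ha
    have h1 : IsNoetherian k (LinearMap.range (f.restrictScalars k)) := by
      exact isNoetherian_of_isNoetherianRing_of_finite k _
    have h2 : IsNoetherian k ((M ⧸ N) →ₗ[Λ] E) := by
      let ev' := ev.codRestrict (LinearMap.range (f.restrictScalars k)) (fun x => hr ⟨x, rfl⟩)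
      exact isNoetherian_of_injective ev' (fun x y h => hev (congrArg Subtype.val h))
    let α : ((M ⧸ N) →ₗ[Λ] E) →ₗ[k] (M →ₗ[Λ] E) :=
      { toFun := fun φ => φ ∘ₗ N.mkQ, map_add' := fun _ _ => rfl, map_smul' := fun _ _ => rfl }
    let β : (M →ₗ[Λ] E) →ₗ[k] (N →ₗ[Λ] E) :=
      { toFun := fun φ => φ ∘ₗ N.subtype, map_add' := fun _ _ => rfl, map_smul' := fun _ _ => rfl }
    refine isNoetherian_of_range_eq_ker α β ?_
    apply le_antisymm
    · rintro _ ⟨φ, rfl⟩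
      show _ ∘ₗ _ = 0
      ext x
      have : N.mkQ (x : M) = 0 := by simp
      show φ (N.mkQ x) = 0
      rw [this, map_zero]
    · intro φ hφ
      refine ⟨N.liftQ φ ?_, ?_⟩
      · intro x hx
        exact LinearMap.congr_fun (show φ ∘ₗ N.subtype = 0 from hφ) ⟨x, hx⟩
      · exact Submodule.liftQ_mkQ _ _ _

lemma exists_fg_injective (Λ : Type) [Ring Λ] (k : Type) [CommRing k] [IsArtinianRing k] [Algebra k Λ]
    [Module.Finite k Λ] (X : Type) [AddCommGroup X] [Module Λ X] [Module.Finite Λ X] :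
    ∃ (E : ModuleCat.{0} Λ) (f : X →ₗ[Λ] E), Module.Finite Λ E ∧ Module.Injective Λ E ∧
      Injective f := by
  obtain ⟨E, f, hE, hf, hess⟩ := exists_hull (Λ := Λ) X
  let : Module k X := Module.compHom X (algebraMap k Λ)
  let : Module k E := Module.compHom E (algebraMap k Λ)
  have : IsScalarTower k Λ X := IsScalarTower.of_algebraMap_smul fun _ _ => rfl
  have : IsScalarTower k Λ E := IsScalarTower.of_algebraMap_smul fun _ _ => rfl
  have : SMulCommClass Λ k E := IsScalarTower.to_smulCommClass'
  have : Module.Finite k X := Module.Finite.trans Λ X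
  have : IsArtinianRing Λ := IsArtinianRing.of_finite k Λ
  have hn : IsNoetherian k (Λ →ₗ[Λ] E) :=
    hom_noeth f hf hess ((isArtinianRing_iff_isFiniteLength Λ).1 inferInstance)
  let ev : (Λ →ₗ[Λ] E) →ₗ[k] E :=
      { toFun := fun φ => φ 1, map_add' := fun _ _ => rfl, map_smul' := fun _ _ => rfl }
  have hfin : Module.Finite k E := Module.Finite.of_surjective ev (fun e =>
    ⟨LinearMap.toSpanSingleton Λ E e, by simp [ev]⟩)
  exact ⟨E, f, Module.Finite.of_restrictScalars_finite k Λ E, hE, hf⟩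

end Hull

section MainPart

variable {Λ : Type} [Ring Λ]

lemma IsProjInj.pi {Q : Type} [AddCommGroup Q] [Module Λ Q] (h : IsProjInj Λ Q) (m : ℕ) :
    IsProjInj Λ (Fin m → Q) := by
  have := h.1
  have := h.2
  exact ⟨Module.Projective.of_equiv (DFinsupp.linearEquivFunOnFintype (R := Λ)
    (M := fun _ : Fin m => Q)), inferInstance⟩

lemma IsProjInj.prod {Q R : Type} [AddCommGroup Q] [Module Λ Q] [AddCommGroup R] [Module Λ R]
    (h : IsProjInj Λ Q) (h' : IsProjInj Λ R) : IsProjInj Λ (Q × R) := by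
  have := h.1
  have := h'.1
  refine ⟨inferInstance, ⟨?_⟩⟩
  intro X Y _ _ _ _ f hf g
  obtain ⟨u, hu⟩ := h.2.out f hf (LinearMap.fst Λ _ _ ∘ₗ g)
  obtain ⟨v, hv⟩ := h'.2.out f hf (LinearMap.snd Λ _ _ ∘ₗ g)
  exact ⟨u.prod v, fun x => Prod.ext (hu x) (hv x)⟩

lemma inAdd_pi (T : Type) [AddCommGroup T] [Module Λ T] (n : ℕ) : InAddOf Λ T (Fin n → T) :=
  ⟨n, LinearMap.id, LinearMap.id, rfl⟩

lemma inAdd_of_proj (P : Type) [AddCommGroup P] [Module Λ P] [Module.Finite Λ P]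
    [Module.Projective Λ P] : InAddOf Λ Λ P := by
  obtain ⟨n, f, hf⟩ := Module.Finite.exists_fin' Λ P
  obtain ⟨s, hs⟩ := Module.projective_lifting_property f LinearMap.id hf
  exact ⟨n, f, s, hs⟩

/-- summands of cogenerated modules are cogenerated -/
lemma cogen_add {T M : Type} [AddCommGroup T] [Module Λ T] [AddCommGroup M] [Module Λ M]
    (hT : CogenByProjInj Λ T) (h : InAddOf Λ T M) : CogenByProjInj Λ M := by
  obtain ⟨Q, hQf, hQ, f, hf⟩ := hT
  obtain ⟨m, p, s, hps⟩ := h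
  refine ⟨ModuleCat.of Λ (Fin m → Q), inferInstanceAs (Module.Finite Λ (Fin m → Q)), hQ.pi m,
    (LinearMap.pi fun i => f ∘ₗ LinearMap.proj i) ∘ₗ s, ?_⟩
  intro x y hxy
  have h1 : s x = s y := by
    ext i
    exact hf (congrFun hxy i)
  have h2 := congrArg p h1
  have h3 := LinearMap.congr_fun hps
  simp only [LinearMap.comp_apply, LinearMap.id_apply] at h3
  rwa [h3, h3] at h2

lemma finite_sub [IsNoetherianRing Λ] {P : Type} [AddCommGroup P] [Module Λ P] [Module.Finite Λ P]
    (K : Submodule Λ P) : Module.Finite Λ K := by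
  have : IsNoetherian Λ P := isNoetherian_of_isNoetherianRing_of_finite Λ P
  infer_instance

lemma pd_succ [IsNoetherianRing Λ] : ∀ (d : ℕ) (X : ModuleCat.{0} Λ), Module.Finite Λ X →
    pdLEcat Λ d X → pdLEcat Λ (d+1) X
  | 0, X, hf, h => by
    refine ⟨X, LinearMap.id, h, hf, surjective_id, ?_⟩
    have : Subsingleton (LinearMap.ker (LinearMap.id : X →ₗ[Λ] X)) := by
      rw [LinearMap.ker_id]; infer_instance
    show Module.Projective Λ (LinearMap.ker (LinearMap.id : X →ₗ[Λ] X))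
    infer_instance
  | d+1, X, hf, h => by
    obtain ⟨P, g, hP, hPf, hg, hK⟩ := h
    exact ⟨P, g, hP, hPf, hg, pd_succ d _ (finite_sub (LinearMap.ker g)) hK⟩

lemma pd_three_two [IsNoetherianRing Λ] (h3 : ∀ X : ModuleCat.{0} Λ, EV Λ 3 X Λ)
    (X : ModuleCat.{0} Λ) (h : pdLEcat Λ 3 X) : pdLEcat Λ 2 X := by
  obtain ⟨P0, g0, hP0, hf0, hg0, P1, g1, hP1, hf1, hg1, P2, g2, hP2, hf2, hg2, hK⟩ := h
  refine ⟨P0, g0, hP0, hf0, hg0, P1, g1, hP1, hf1, hg1, ?_⟩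
  have hK' : Module.Projective Λ (LinearMap.ker g2) := hK
  have hKf : Module.Finite Λ (LinearMap.ker g2) := finite_sub _
  have e3 : EV Λ 3 X (LinearMap.ker g2) := EV_add_right (inAdd_of_proj _) (h3 X)
  have e2 : EV Λ 2 (LinearMap.ker g0) (LinearMap.ker g2) := (ses_ker hg0).contra1 (EV_proj 1) e3
  have e1 : EV Λ 1 (LinearMap.ker g1) (LinearMap.ker g2) := (ses_ker hg1).contra1 (EV_proj 0) e2
  obtain ⟨ψ, hψ⟩ := (ses_ker hg2).lift e1 LinearMap.id
  exact Module.Projective.of_split ψ g2 hψ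

lemma pd_le_two [IsNoetherianRing Λ] (h3 : ∀ X : ModuleCat.{0} Λ, EV Λ 3 X Λ) :
    ∀ (d : ℕ) (X : ModuleCat.{0} Λ), Module.Finite Λ X → pdLEcat Λ d X → pdLEcat Λ 2 X
  | 0, X, hf, h => pd_succ 1 X hf (pd_succ 0 X hf h)
  | 1, X, hf, h => pd_succ 1 X hf h
  | 2, X, hf, h => h
  | n+3, X, hf, h => by
    obtain ⟨P, g, hP, hPf, hg, hK⟩ := h
    exact pd_three_two h3 X ⟨P, g, hP, hPf, hg,
      pd_le_two h3 (n+2) _ (finite_sub (LinearMap.ker g)) hK⟩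

lemma forward (k : Type) [CommRing k] [IsArtinianRing k] [Algebra k Λ]
    [Module.Finite k Λ] [IsNoetherianRing Λ] (hfin : ∃ d, GlobalDimLE Λ d)
    (T : ModuleCat.{0} Λ) (hT : IsTilting Λ T) (hcT : IsCotilting Λ T)
    (hC : MemC Λ T) : GlobalDimLE Λ 2 ∧ DomdimGE2 Λ := by
  obtain ⟨-, -, T0, T1, f, g, hT0, hT1, hf, hg, hfg⟩ := hT
  obtain ⟨hid, -, hco⟩ := hcT
  have hses : SES f g := ⟨hf, hg, hfg⟩
  constructor
  · obtain ⟨d, hd⟩ := hfin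
    intro X hX
    refine pd_le_two (fun Y => ?_) d X hX (hd X hX)
    have hTn : ∀ i, 1 < i → EV Λ i Y T := fun i hi => idLEcat_EV 1 _ hid i hi
    exact hses.cov1 (EV_add_right hT1 (hTn 2 (by norm_num))) (EV_add_right hT0 (hTn 3 (by norm_num)))
  · obtain ⟨Q0, hQ0f, hQ0, i0, hi0⟩ := cogen_add hC.2 hT0
    have hinj : Injective (i0 ∘ₗ f) := hi0.comp hf
    have := hQ0.1
    have hCT : EV Λ 1 (Q0 ⧸ LinearMap.range (i0 ∘ₗ f)) T := by
      refine (ses_coker hinj).EV_of_extend (EV_proj 0) ?_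
      intro φ
      obtain ⟨Q, hQf, hQ, q, hq⟩ := hC.1
      obtain ⟨χ, hχ⟩ := Module.projective_lifting_property q φ hq
      obtain ⟨ψ, hψ⟩ := hQ.2.out (i0 ∘ₗ f) hinj χ
      refine ⟨q ∘ₗ ψ, ?_⟩
      rw [← hχ]
      apply LinearMap.ext
      intro x
      exact congrArg q (hψ x)
    obtain ⟨E, j, hEf, hE, hj⟩ := exists_fg_injective Λ k (Q0 ⧸ LinearMap.range (i0 ∘ₗ f))
    obtain ⟨C0, C1, u, v, hC0, hC1, hu, hv, huv⟩ := hco E hEf hE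
    have hses2 : SES u v := ⟨hu, hv, huv⟩
    obtain ⟨w, hw⟩ := hses2.lift (EV_add_right hC0 hCT) j
    obtain ⟨Q1, hQ1f, hQ1, i1, hi1⟩ := cogen_add hC.2 hC1
    have hwinj : Injective w := by
      have : Injective (v ∘ₗ w) := hw ▸ hj
      exact Injective.of_comp this
    refine ⟨Q0, Q1, i0 ∘ₗ f, (i1 ∘ₗ w) ∘ₗ (LinearMap.range (i0 ∘ₗ f)).mkQ, hQ0f, hQ0, hQ1f, hQ1,
      hinj, ?_⟩
    have h0 : Injective (i1 ∘ₗ w) := hi1.comp hwinj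
    rw [LinearMap.ker_comp_of_ker_eq_bot _ (LinearMap.ker_eq_bot.2 h0), Submodule.ker_mkQ]

lemma approx (k : Type) [CommRing k] [IsArtinianRing k] [Algebra k Λ]
    [Module.Finite k Λ] {T T0 T1 : Type} [AddCommGroup T] [Module Λ T]
    [AddCommGroup T0] [Module Λ T0] [AddCommGroup T1] [Module Λ T1] [Module.Finite Λ T]
    {f : Λ →ₗ[Λ] T0} {g : T0 →ₗ[Λ] T1} (hs : SES f g) (hT0 : InAddOf Λ T T0)
    (hT1 : InAddOf Λ T T1) (hTT : EV Λ 1 T T)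
    (X : Type) [AddCommGroup X] [Module Λ X] [Module.Finite Λ X] (hX : EV Λ 1 T X) :
    ∃ (n : ℕ) (p : (Fin n → T) →ₗ[Λ] X), Surjective p ∧ EV Λ 1 T (LinearMap.ker p) := by
  let _ : Module k X := Module.compHom X (algebraMap k Λ)
  let _ : Module k T := Module.compHom T (algebraMap k Λ)
  have : IsScalarTower k Λ X := IsScalarTower.of_algebraMap_smul fun _ _ => rfl
  have : IsScalarTower k Λ T := IsScalarTower.of_algebraMap_smul fun _ _ => rfl
  have : SMulCommClass Λ k X := IsScalarTower.to_smulCommClass'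
  have : SMulCommClass Λ k T := IsScalarTower.to_smulCommClass'
  have : Module.Finite k X := Module.Finite.trans Λ X
  obtain ⟨m, c, hc⟩ := Module.Finite.exists_fin' Λ T
  have hfinH : Module.Finite k (T →ₗ[Λ] X) := by
    let ev : (T →ₗ[Λ] X) →ₗ[k] (Fin m → X) :=
      { toFun := fun φ i => φ (c (Pi.single i 1)), map_add' := fun _ _ => rfl,
        map_smul' := fun _ _ => rfl }
    have hev : Injective ev := by
      intro φ ψ h
      have : φ ∘ₗ c = ψ ∘ₗ c := by
        apply LinearMap.pi_ext'
        intro i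
        ext
        exact congrFun h i
      apply LinearMap.ext
      intro t
      obtain ⟨z, rfl⟩ := hc t
      exact LinearMap.congr_fun this z
    exact Module.Finite.of_injective ev hev
  obtain ⟨n, b, hb⟩ := Module.Finite.exists_fin' k (T →ₗ[Λ] X)
  let h : Fin n → (T →ₗ[Λ] X) := fun i => b (Pi.single i 1)
  let p : (Fin n → T) →ₗ[Λ] X := ∑ i, h i ∘ₗ LinearMap.proj i
  have hp : ∀ z, p z = ∑ i, h i (z i) := fun z => by simp [p]
  have hlift : ∀ φ : T →ₗ[Λ] X, ∃ ψ : T →ₗ[Λ] (Fin n → T), p ∘ₗ ψ = φ := by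
    intro φ
    obtain ⟨a, rfl⟩ := hb φ
    refine ⟨LinearMap.pi fun i => a i • LinearMap.id, ?_⟩
    apply LinearMap.ext
    intro t
    have h1 : b a = ∑ i, a i • h i := by
      conv_lhs => rw [pi_eq_sum_univ' a]
      simp [h, map_sum, map_smul]
    rw [h1, LinearMap.comp_apply, hp]
    simp only [LinearMap.pi_apply, LinearMap.smul_apply, LinearMap.id_apply, LinearMap.sum_apply]
    refine Finset.sum_congr rfl fun i _ => ?_
    exact (h i).map_smul_of_tower (a i) t
  have hsurj : Surjective p := by
    intro x
    obtain ⟨ψ, hψ⟩ := hs.extend (EV_add_left hT1 hX) (LinearMap.toSpanSingleton Λ X x)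
    obtain ⟨r, α, β, hαβ⟩ := hT0.sum
    choose χ hχ using fun i => hlift (ψ ∘ₗ α i)
    refine ⟨∑ i, χ i (β i (f 1)), ?_⟩
    have h1 := LinearMap.congr_fun hψ 1
    simp only [LinearMap.comp_apply, LinearMap.toSpanSingleton_apply, one_smul] at h1
    have h2 := LinearMap.congr_fun hαβ (f 1)
    simp only [LinearMap.sum_apply, LinearMap.comp_apply, LinearMap.id_apply] at h2
    rw [← h1, ← h2, map_sum, map_sum]
    refine Finset.sum_congr rfl fun i _ => ?_
    rw [h2]
    exact LinearMap.congr_fun (hχ i) (β i (f 1))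
  exact ⟨n, p, hsurj, (ses_ker hsurj).EV_of_lift (EV_add_right (inAdd_pi T n) hTT) hlift⟩

lemma backward_aux (k : Type) [CommRing k] [IsArtinianRing k] [Algebra k Λ]
    [Module.Finite k Λ] [IsNoetherianRing Λ] (hg : GlobalDimLE Λ 2)
    {T T0 T1 P : ModuleCat.{0} Λ} [Module.Finite Λ T] [Module.Finite Λ P]
    {f : Λ →ₗ[Λ] T0} {g : T0 →ₗ[Λ] T1} (hs : SES f g) (hT0 : InAddOf Λ T T0)
    (hT1 : InAddOf Λ T T1) {f' : Λ →ₗ[Λ] P} {g' : P →ₗ[Λ] T} (hs' : SES f' g')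
    (hP : IsProjInj Λ P) : IsTilting Λ T ∧ IsCotilting Λ T := by
  have hP1 := hP.1
  have hP2 := hP.2
  have hpd : pdLE Λ 1 T := by
    refine ⟨P, g', hP.1, inferInstance, hs'.surj, ?_⟩
    let e : Λ ≃ₗ[Λ] LinearMap.ker g' :=
      (LinearEquiv.ofInjective f' hs'.inj).trans (LinearEquiv.ofEq _ _ hs'.ex)
    exact Module.Projective.of_equiv e
  have hTT : EV Λ 1 T T :=
    hs'.cov3 (EV_inj 0) (pdLEcat_EV 1 T hpd 2 (by norm_num))
  have hE2 : ∀ (X : Type) [AddCommGroup X] [Module Λ X] [Module.Finite Λ X], EV Λ 2 X T :=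
    fun X _ _ hX => hs'.cov3 (EV_inj 1) (pdLEcat_EV 2 (ModuleCat.of Λ X) (hg _ hX) 3 (by norm_num))
  refine ⟨⟨hpd, ext1Vanish_iff.2 hTT, T0, T1, f, g, hT0, hT1, hs.inj, hs.surj, hs.ex⟩, ?_,
    ext1Vanish_iff.2 hTT, ?_⟩
  · obtain ⟨J, j, hJ, hj⟩ := exists_injective_emb (Λ := Λ) T
    refine ⟨J, j, hJ, hj, ?_⟩
    exact injective_of_EV fun I => (ses_coker hj).cov3 (EV_inj 0) (hE2 _)
  · intro I hIf hI
    obtain ⟨m, p, hp, hK⟩ := approx k hs hT0 hT1 hTT I (EV_inj 0)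
    have hKf : Module.Finite Λ (LinearMap.ker p) := finite_sub _
    have hKT : EV Λ 1 (LinearMap.ker p) T :=
      (ses_ker hp).contra1 (EV_add_left (inAdd_pi T m) hTT) (hE2 I)
    obtain ⟨m', p', hp', hL⟩ := approx k hs hT0 hT1 hTT _ hK
    have hLf : Module.Finite Λ (LinearMap.ker p') := finite_sub _
    obtain ⟨m2, p2, hp2, hL2⟩ := approx k hs hT0 hT1 hTT _ hL
    have hL2f : Module.Finite Λ (LinearMap.ker p2) := finite_sub _
    obtain ⟨m3, p3, hp3, hL3⟩ := approx k hs hT0 hT1 hTT _ hL2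
    have e2 : EV Λ 2 (LinearMap.ker p) (LinearMap.ker p2) :=
      (ses_ker hp3).cov3 (EV_add_right (inAdd_pi T m3) (hE2 _))
        (pdLEcat_EV 2 (ModuleCat.of Λ (LinearMap.ker p)) (hg _ hKf) 3 (by norm_num))
    have e1 : EV Λ 1 (LinearMap.ker p) (LinearMap.ker p') :=
      (ses_ker hp2).cov3 (EV_add_right (inAdd_pi T m2) hKT) e2
    obtain ⟨s, hsec⟩ := (ses_ker hp').lift e1 LinearMap.id
    exact ⟨ModuleCat.of Λ (LinearMap.ker p), ModuleCat.of Λ (Fin m → T), (LinearMap.ker p).subtype, p,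
      ⟨m', p', s, hsec⟩, inAdd_pi T m, Subtype.val_injective, hp, by simp⟩

lemma backward (k : Type) [CommRing k] [IsArtinianRing k] [Algebra k Λ]
    [Module.Finite k Λ] [IsNoetherianRing Λ] (hg : GlobalDimLE Λ 2) (hd : DomdimGE2 Λ) :
    ∃ T : ModuleCat.{0} Λ, Module.Finite Λ T ∧ IsTilting Λ T ∧ IsCotilting Λ T ∧ MemC Λ T := by
  obtain ⟨Q0, Q1, f, g, hQ0f, hQ0, hQ1f, hQ1, hf, hfg⟩ := hd
  let C := Q0 ⧸ LinearMap.range f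
  let q : Q0 →ₗ[Λ] C := (LinearMap.range f).mkQ
  let π : Q0 × Q0 →ₗ[Λ] Q0 × C := LinearMap.prodMap LinearMap.id q
  have hπ : Surjective π := Function.Surjective.prodMap surjective_id (Submodule.mkQ_surjective _)
  have hTf : Module.Finite Λ (Q0 × C) := inferInstance
  have hs' : SES (LinearMap.inr Λ Q0 Q0 ∘ₗ f) π := by
    refine ⟨LinearMap.inr_injective.comp hf, hπ, ?_⟩
    apply le_antisymm
    · rintro _ ⟨x, rfl⟩
      have h0 : q (f x) = 0 := (Submodule.Quotient.mk_eq_zero _).2 ⟨x, rfl⟩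
      simp [π, h0]
    · rintro ⟨x, y⟩ hxy
      simp only [π, LinearMap.mem_ker, LinearMap.prodMap_apply, Prod.mk_eq_zero] at hxy
      obtain ⟨z, rfl⟩ := (Submodule.Quotient.mk_eq_zero _).1 hxy.2
      have : x = 0 := hxy.1
      exact ⟨z, by simp [this]⟩
  have hA0 : InAddOf Λ (Q0 × C) Q0 :=
    ⟨1, LinearMap.fst Λ _ _ ∘ₗ LinearMap.proj 0, LinearMap.pi fun _ => LinearMap.inl Λ _ _, rfl⟩
  have hA1 : InAddOf Λ (Q0 × C) C :=
    ⟨1, LinearMap.snd Λ _ _ ∘ₗ LinearMap.proj 0, LinearMap.pi fun _ => LinearMap.inr Λ _ _, rfl⟩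
  have key := backward_aux (T := ModuleCat.of Λ (Q0 × C)) (T0 := Q0) (T1 := ModuleCat.of Λ C)
    (P := ModuleCat.of Λ (Q0 × Q0)) k hg (ses_coker hf) hA0 hA1 hs' (hQ0.prod hQ0)
  let g' : C →ₗ[Λ] Q1 := (LinearMap.range f).liftQ g hfg.le
  have hg' : Injective g' := by
    rw [← LinearMap.ker_eq_bot]
    exact Submodule.ker_liftQ_eq_bot' _ _ hfg
  refine ⟨ModuleCat.of Λ (Q0 × C), hTf, key.1, key.2, ?_, ?_⟩
  · exact ⟨ModuleCat.of Λ (Q0 × Q0), inferInstanceAs (Module.Finite Λ (Q0 × Q0)), hQ0.prod hQ0, π, hπ⟩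
  · exact ⟨ModuleCat.of Λ (Q0 × Q1), inferInstanceAs (Module.Finite Λ (Q0 × Q1)), hQ0.prod hQ1,
      LinearMap.prodMap LinearMap.id g', Function.Injective.prodMap injective_id hg'⟩

end MainPart

theorem stmt14 (Λ : Type) [Ring Λ] (k : Type) [CommRing k] [IsArtinianRing k] [Algebra k Λ]
    [Module.Finite k Λ]
    (hfin : ∃ d, GlobalDimLE Λ d) :
    (∃ T : ModuleCat.{0} Λ, Module.Finite Λ T ∧ IsTilting Λ T ∧ IsCotilting Λ T ∧ MemC Λ T)
    ↔ (GlobalDimLE Λ 2 ∧ DomdimGE2 Λ) := by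
  have : IsNoetherianRing Λ := isNoetherian_of_tower k (isNoetherian_of_isNoetherianRing_of_finite k Λ)
  constructor
  · rintro ⟨T, -, h1, h2, h3⟩
    exact forward k hfin T h1 h2 h3
  · rintro ⟨h1, h2⟩
    exact backward k h1 h2
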